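/- For k ≥ 3, any diregular (2,k,+3)-digraph G contains a pair of vertices u, v with exactly one common out-neighbour, i.e. |N^+(u) ∩ N^+(v)| = 1. -/

import Mathlib

/-- `p` is a directed walk from `u` to `v` in the digraph with arc relation `A`,
recorded as the list of its vertices; a walk of length `l` (i.e. with `l` arcs)
is a list of `l + 1` vertices. -/
def IsWalkFrom {V : Type*} (A : V → V → Prop) (u v : V) (p : List V) : Prop :=
  p.Chain' A ∧ p.head? = some u ∧ p.getLast? = some v

/-- A digraph is `k`-geodetic if for every ordered pair of vertices `(u, v)`
there is at most one directed path of length at most `k` from `u` to `v`. -/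
def IsKGeodetic {V : Type*} (A : V → V → Prop) (k : ℕ) : Prop :=
  ∀ (u v : V) (p q : List V), IsWalkFrom A u v p → IsWalkFrom A u v q →
    p.length ≤ k + 1 → q.length ≤ k + 1 → p = q

/-- `Nout A u = N⁺(u)`, the set of out-neighbours of `u`. -/
def Nout {V : Type*} (A : V → V → Prop) (u : V) : Set V := {v | A u v}

/-- `Nin A u = N⁻(u)`, the set of in-neighbours of `u`. -/
def Nin {V : Type*} (A : V → V → Prop) (u : V) : Set V := {v | A v u}

/-- `NIter A l u = N^l(u)`, the set of vertices reachable from `u` by a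
directed path of length exactly `l`. -/
def NIter {V : Type*} (A : V → V → Prop) (l : ℕ) (u : V) : Set V :=
  {v | ∃ p : List V, IsWalkFrom A u v p ∧ p.length = l + 1}

/-- `Ball A l u = T_l(u) = N^0(u) ∪ N^1(u) ∪ ⋯ ∪ N^l(u)`, the set of vertices
at distance at most `l` from `u`. -/
def Ball {V : Type*} (A : V → V → Prop) (l : ℕ) (u : V) : Set V :=
  {v | ∃ m ≤ l, v ∈ NIter A m u}

/-- `Outliers A k u = O(u) = {v | d(u,v) ≥ k + 1}`, the outlier set of `u`. -/
def Outliers {V : Type*} (A : V → V → Prop) (k : ℕ) (u : V) : Set V :=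
  {v | v ∉ Ball A k u}

/-- A digraph is diregular with degree `d` if every vertex has out-degree `d`
and in-degree `d`. -/
def IsDiregular {V : Type*} (A : V → V → Prop) (d : ℕ) : Prop :=
  ∀ u : V, (Nout A u).ncard = d ∧ (Nin A u).ncard = d

/-- The Moore bound `M(d,k) = 1 + d + d² + ⋯ + d^k`. -/
def moore (d k : ℕ) : ℕ := ∑ i ∈ Finset.range (k + 1), d ^ i

open scoped Classical in
/-- The adjacency matrix of the digraph with arc relation `A`. -/
noncomputable def arcMatrix {V : Type*} (A : V → V → Prop) : Matrix V V ℕ :=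
  Matrix.of fun u v => if A u v then 1 else 0

open scoped Classical in
/-- The indicator matrix of pairs of vertices with the same out-neighbours. -/
noncomputable def sameOutMatrix {V : Type*} (A : V → V → Prop) : Matrix V V ℕ :=
  Matrix.of fun u v => if Nout A u = Nout A v then 1 else 0

open scoped Classical in
/-- The indicator matrix of pairs of vertices with the same in-neighbours. -/
noncomputable def sameInMatrix {V : Type*} (A : V → V → Prop) : Matrix V V ℕ :=
  Matrix.of fun u v => if Nin A u = Nin A v then 1 else 0

theorem Finset.sum_le_one_of_pairwise {ι : Type*} (s : Finset ι) (f : ι → ℕ)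
    (h1 : ∀ i ∈ s, f i ≤ 1)
    (h2 : ∀ i ∈ s, ∀ j ∈ s, f i ≠ 0 → f j ≠ 0 → i = j) : ∑ i ∈ s, f i ≤ 1 := by
  by_cases h : ∃ i ∈ s, f i ≠ 0
  · obtain ⟨i, hi, hfi⟩ := h
    rw [Finset.sum_eq_single_of_mem i hi]
    · exact h1 i hi
    · intro j hj hji
      by_contra hfj
      exact hji (h2 j hj i hi hfj hfi)
  · push Not at h
    rw [Finset.sum_eq_zero h]
    exact zero_le_one

theorem Matrix.sum_mul_row {V : Type*} [Fintype V] {M N : Matrix V V ℕ} {a b : ℕ}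
    (hM : ∀ u, ∑ v, M u v = a) (hN : ∀ u, ∑ v, N u v = b) (u : V) :
    ∑ v, (M * N) u v = a * b := by
  simp only [Matrix.mul_apply]
  rw [Finset.sum_comm]
  simp only [← Finset.mul_sum, hN, ← Finset.sum_mul, hM]

theorem Matrix.sum_pow_row {V : Type*} [Fintype V] [DecidableEq V] {M : Matrix V V ℕ} {a : ℕ}
    (hM : ∀ u, ∑ v, M u v = a) (m : ℕ) (u : V) : ∑ v, (M ^ m) u v = a ^ m := by
  induction m generalizing u with
  | zero => simp [Matrix.one_apply]
  | succ m ih => rw [pow_succ, pow_succ, Matrix.sum_mul_row ih hM]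

section

variable {V : Type*} {A : V → V → Prop}

theorem isWalkFrom_singleton (u : V) : IsWalkFrom A u u [u] :=
  ⟨List.isChain_singleton u, rfl, rfl⟩

theorem IsWalkFrom.cons {u w v : V} {p : List V} (h : A u w) (hp : IsWalkFrom A w v p) :
    IsWalkFrom A u v (u :: p) := by
  obtain ⟨h1, h2, h3⟩ := hp
  cases p with
  | nil => simp at h2
  | cons x p =>
    simp only [List.head?_cons, Option.some.injEq] at h2
    subst h2
    refine ⟨List.isChain_cons_cons.2 ⟨h, h1⟩, rfl, ?_⟩
    rw [List.getLast?_cons_cons]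
    exact h3

theorem arcMatrix_ne_zero {u v : V} : arcMatrix A u v ≠ 0 ↔ A u v := by
  simp [arcMatrix]

theorem sameOutMatrix_ne_zero {u v : V} : sameOutMatrix A u v ≠ 0 ↔ Nout A u = Nout A v := by
  simp [sameOutMatrix]

theorem sameInMatrix_ne_zero {u v : V} : sameInMatrix A u v ≠ 0 ↔ Nin A u = Nin A v := by
  simp [sameInMatrix]

theorem arcMatrix_congr {u u' v v' : V} (h : A u v ↔ A u' v') :
    arcMatrix A u v = arcMatrix A u' v' :=
  by classical exact if_congr h rfl rfl

theorem IsDiregular.nonempty_nout {d : ℕ} (hd : d ≠ 0) (h : IsDiregular A d) (u : V) :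
    ∃ v, A u v :=
  Set.nonempty_of_ncard_ne_zero (s := Nout A u) (by rw [(h u).1]; exact hd)

theorem IsDiregular.nonempty_nin {d : ℕ} (hd : d ≠ 0) (h : IsDiregular A d) (u : V) :
    ∃ v, A v u :=
  Set.nonempty_of_ncard_ne_zero (s := Nin A u) (by rw [(h u).2]; exact hd)

theorem nin_eq_of_common
    (hA : ∀ {u v w : V}, A u w → A v w → Nout A u = Nout A v)
    {u v w : V} (hu : A w u) (hv : A w v) : Nin A u = Nin A v := by
  ext x
  constructor <;> intro hx
  · have : v ∈ Nout A x := by rw [hA hx hu]; exact hv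
    exact this
  · have : u ∈ Nout A x := by rw [hA hx hv]; exact hu
    exact this

variable [Fintype V]

open scoped Classical in
theorem sum_ite_mem_eq_ncard (s : Set V) : ∑ v, (if v ∈ s then 1 else 0) = s.ncard := by
  rw [Set.ncard_eq_toFinset_card', Finset.sum_boole]
  simp [Set.toFinset]

theorem IsDiregular.sum_arcMatrix_row {d : ℕ} (h : IsDiregular A d) (u : V) :
    ∑ v, arcMatrix A u v = d := by
  rw [← (h u).1, ← sum_ite_mem_eq_ncard]; rfl

theorem IsDiregular.sum_arcMatrix_col {d : ℕ} (h : IsDiregular A d) (v : V) :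
    ∑ u, arcMatrix A u v = d := by
  rw [← (h v).2, ← sum_ite_mem_eq_ncard]; rfl

/-- If no two vertices have exactly one common out-neighbour, vertices sharing an out-neighbour
have the same out-neighbours. -/
theorem nout_eq_of_common (hreg : IsDiregular A 2)
    (hA : ∀ u v : V, u ≠ v → (Nout A u ∩ Nout A v).ncard ≠ 1)
    {u v w : V} (hu : A u w) (hv : A v w) : Nout A u = Nout A v := by
  rcases eq_or_ne u v with rfl | huv
  · rfl
  have h0 : (Nout A u ∩ Nout A v).ncard ≠ 0 :=
    Set.ncard_ne_zero_of_mem (a := w) ⟨hu, hv⟩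
  have h1 := hA u v huv
  have hu2 : Nout A u ∩ Nout A v = Nout A u :=
    Set.eq_of_subset_of_ncard_le Set.inter_subset_left (by rw [(hreg u).1]; omega)
  have hv2 : Nout A u ∩ Nout A v = Nout A v :=
    Set.eq_of_subset_of_ncard_le Set.inter_subset_right (by rw [(hreg v).1]; omega)
  rw [← hu2, hv2]

theorem sum_sameOutMatrix_row (hreg : IsDiregular A 2)
    (hA : ∀ {u v w : V}, A u w → A v w → Nout A u = Nout A v) (u : V) :
    ∑ v, sameOutMatrix A u v = 2 := by
  obtain ⟨w, hw⟩ := hreg.nonempty_nout two_ne_zero u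
  rw [← hreg.sum_arcMatrix_col w]
  refine Finset.sum_congr rfl fun v _ => ?_
  have : Nout A u = Nout A v ↔ A v w :=
    ⟨fun h => by
      have : w ∈ Nout A v := by rw [← h]; exact hw
      exact this, fun h => hA hw h⟩
  classical exact if_congr this rfl rfl

theorem sum_sameInMatrix_row (hreg : IsDiregular A 2)
    (hA : ∀ {u v w : V}, A u w → A v w → Nout A u = Nout A v) (u : V) :
    ∑ v, sameInMatrix A u v = 2 := by
  obtain ⟨w, hw⟩ := hreg.nonempty_nin two_ne_zero u
  rw [← hreg.sum_arcMatrix_row w]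
  refine Finset.sum_congr rfl fun v _ => ?_
  have : Nin A u = Nin A v ↔ A w v :=
    ⟨fun h => by
      have : w ∈ Nin A v := by rw [← h]; exact hw
      exact this, fun h => nin_eq_of_common hA hw h⟩
  classical exact if_congr this rfl rfl

theorem sameOut_mul_sameIn_le_one (hreg : IsDiregular A 2) {k : ℕ} (hk : 2 ≤ k)
    (hgeo : IsKGeodetic A k) (u v : V) : (sameOutMatrix A * sameInMatrix A) u v ≤ 1 := by
  rw [Matrix.mul_apply]
  refine Finset.sum_le_one_of_pairwise _ _ (fun w _ => ?_) (fun w _ x _ hw hx => ?_)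
  · refine mul_le_one' ?_ ?_
    · simp only [sameOutMatrix, Matrix.of_apply]
      split_ifs <;> simp
    · simp only [sameInMatrix, Matrix.of_apply]
      split_ifs <;> simp
  · have hwo := sameOutMatrix_ne_zero.1 (left_ne_zero_of_mul hw)
    have hwi := sameInMatrix_ne_zero.1 (right_ne_zero_of_mul hw)
    have hxo := sameOutMatrix_ne_zero.1 (left_ne_zero_of_mul hx)
    have hxi := sameInMatrix_ne_zero.1 (right_ne_zero_of_mul hx)
    obtain ⟨s, hs⟩ := hreg.nonempty_nout two_ne_zero u
    obtain ⟨r, hr⟩ := hreg.nonempty_nin two_ne_zero v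
    have hws : A w s := (Set.ext_iff.1 hwo s).1 hs
    have hxs : A x s := (Set.ext_iff.1 hxo s).1 hs
    have hrw : A r w := (Set.ext_iff.1 hwi r).2 hr
    have hrx : A r x := (Set.ext_iff.1 hxi r).2 hr
    have h := hgeo r s _ _ (((isWalkFrom_singleton s).cons hws).cons hrw)
      (((isWalkFrom_singleton s).cons hxs).cons hrx) (by simp; omega) (by simp; omega)
    simpa using h

variable [DecidableEq V]

theorem exists_walk_of_pow_ne_zero (m : ℕ) (u v : V) (h : (arcMatrix A ^ m) u v ≠ 0) :
    ∃ p, IsWalkFrom A u v p ∧ p.length = m + 1 := by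
  induction m generalizing u with
  | zero =>
    have : u = v := by
      by_contra huv
      simp [huv] at h
    subst this
    exact ⟨[u], isWalkFrom_singleton u, rfl⟩
  | succ m ih =>
    rw [pow_succ', Matrix.mul_apply] at h
    obtain ⟨w, -, hw⟩ := Finset.exists_ne_zero_of_sum_ne_zero h
    obtain ⟨p, hp, hlen⟩ := ih w (right_ne_zero_of_mul hw)
    exact ⟨u :: p, hp.cons (arcMatrix_ne_zero.1 (left_ne_zero_of_mul hw)), by simp [hlen]⟩

theorem IsKGeodetic.pow_le_one {k : ℕ} (hgeo : IsKGeodetic A k) (m : ℕ) (hm : m ≤ k) (u v : V) :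
    (arcMatrix A ^ m) u v ≤ 1 := by
  induction m generalizing u with
  | zero =>
    rw [pow_zero, Matrix.one_apply]
    split_ifs <;> simp
  | succ m ih =>
    rw [pow_succ', Matrix.mul_apply]
    refine Finset.sum_le_one_of_pairwise _ _ (fun w _ => ?_) (fun w _ x _ hw hx => ?_)
    · refine mul_le_one' ?_ (ih (by omega) w)
      simp only [arcMatrix, Matrix.of_apply]
      split_ifs <;> simp
    · obtain ⟨p, hp, hpl⟩ := exists_walk_of_pow_ne_zero m w v (right_ne_zero_of_mul hw)
      obtain ⟨q, hq, hql⟩ := exists_walk_of_pow_ne_zero m x v (right_ne_zero_of_mul hx)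
      have h := hgeo u v _ _ (hp.cons (arcMatrix_ne_zero.1 (left_ne_zero_of_mul hw)))
        (hq.cons (arcMatrix_ne_zero.1 (left_ne_zero_of_mul hx)))
        (by simp; omega) (by simp; omega)
      have hpq : p = q := (List.cons.inj h).2
      have h1 := hp.2.1
      rw [hpq, hq.2.1] at h1
      exact (Option.some.inj h1).symm

theorem IsKGeodetic.sum_pow_le_one {k : ℕ} (hgeo : IsKGeodetic A k) (u v : V) :
    ∑ m ∈ Finset.range (k + 1), (arcMatrix A ^ m) u v ≤ 1 := by
  refine Finset.sum_le_one_of_pairwise _ _ (fun m hm => ?_) (fun m hm l hl hm0 hl0 => ?_)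
  · exact hgeo.pow_le_one m (by simpa [Nat.lt_succ_iff] using hm) u v
  · obtain ⟨p, hp, hpl⟩ := exists_walk_of_pow_ne_zero m u v hm0
    obtain ⟨q, hq, hql⟩ := exists_walk_of_pow_ne_zero l u v hl0
    rw [Finset.mem_range] at hm hl
    have h := hgeo u v p q hp hq (by omega) (by omega)
    rw [h] at hpl
    omega

/-- No closed walk has positive length at most `k`. -/
theorem IsKGeodetic.pow_succ_self_eq_zero {k : ℕ} (hgeo : IsKGeodetic A k) {m : ℕ} (hm : m < k)
    (u : V) : (arcMatrix A ^ (m + 1)) u u = 0 := by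
  have h := hgeo.sum_pow_le_one u u
  rw [Finset.sum_range_succ'] at h
  have h' := Finset.single_le_sum (f := fun i => (arcMatrix A ^ (i + 1)) u u)
    (fun _ _ => Nat.zero_le _) (Finset.mem_range.2 hm)
  simp only [pow_zero, Matrix.one_apply_eq] at h h'
  omega

theorem arcMatrix_pow_succ_congr_left {u u' : V} (h : Nout A u = Nout A u') (m : ℕ) (v : V) :
    (arcMatrix A ^ (m + 1)) u v = (arcMatrix A ^ (m + 1)) u' v := by
  rw [pow_succ', Matrix.mul_apply, Matrix.mul_apply]
  refine Finset.sum_congr rfl fun w _ => ?_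
  rw [arcMatrix_congr (Set.ext_iff.1 h w)]

theorem arcMatrix_pow_succ_congr_right {v v' : V} (h : Nin A v = Nin A v') (m : ℕ) (u : V) :
    (arcMatrix A ^ (m + 1)) u v = (arcMatrix A ^ (m + 1)) u v' := by
  rw [pow_succ, Matrix.mul_apply, Matrix.mul_apply]
  refine Finset.sum_congr rfl fun w _ => ?_
  rw [arcMatrix_congr (Set.ext_iff.1 h w)]

theorem walks_add_sameOut_mul_sameIn_le_one (hreg : IsDiregular A 2) {k : ℕ} (hk : 2 ≤ k)
    (hgeo : IsKGeodetic A k) (u v : V) :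
    ∑ m ∈ Finset.range k, (arcMatrix A ^ (m + 1)) u v
      + (sameOutMatrix A * sameInMatrix A) u v ≤ 1 := by
  by_cases h : (sameOutMatrix A * sameInMatrix A) u v = 0
  · have h' := hgeo.sum_pow_le_one u v
    rw [Finset.sum_range_succ'] at h'
    omega
  · have h' := sameOut_mul_sameIn_le_one hreg hk hgeo u v
    rw [Finset.sum_eq_zero, zero_add]
    · exact h'
    · intro m hm
      rw [Matrix.mul_apply] at h
      obtain ⟨g, -, hg⟩ := Finset.exists_ne_zero_of_sum_ne_zero h
      rw [arcMatrix_pow_succ_congr_left (sameOutMatrix_ne_zero.1 (left_ne_zero_of_mul hg)),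
        ← arcMatrix_pow_succ_congr_right (sameInMatrix_ne_zero.1 (right_ne_zero_of_mul hg)),
        hgeo.pow_succ_self_eq_zero (Finset.mem_range.1 hm)]

theorem walks_add_sameOut_mul_sameIn_eq_one (hreg : IsDiregular A 2) {k : ℕ} (hk : 2 ≤ k)
    (hgeo : IsKGeodetic A k) (hcard : Fintype.card V = moore 2 k + 3)
    (hA : ∀ {u v w : V}, A u w → A v w → Nout A u = Nout A v) :
    ∑ m ∈ Finset.range k, arcMatrix A ^ (m + 1) + sameOutMatrix A * sameInMatrix A
      = Matrix.of fun _ _ => 1 := by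
  ext u v
  have hle := walks_add_sameOut_mul_sameIn_le_one hreg hk hgeo u
  have hsum : ∑ v, (∑ m ∈ Finset.range k, (arcMatrix A ^ (m + 1)) u v
      + (sameOutMatrix A * sameInMatrix A) u v) = ∑ _v : V, 1 := by
    rw [Finset.sum_add_distrib, Finset.sum_comm,
      Matrix.sum_mul_row (sum_sameOutMatrix_row hreg hA) (sum_sameInMatrix_row hreg hA)]
    simp only [Matrix.sum_pow_row hreg.sum_arcMatrix_row]
    rw [Finset.sum_const, smul_eq_mul, mul_one, Finset.card_univ, hcard, moore,
      Finset.sum_range_succ']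
    ring
  have h := (Finset.sum_eq_sum_iff_of_le fun v _ => hle v).1 hsum v (Finset.mem_univ v)
  simpa [Matrix.add_apply, Matrix.sum_apply] using h

theorem arcMatrix_commute_sameOut_mul_sameIn (hreg : IsDiregular A 2) {k : ℕ} (hk : 2 ≤ k)
    (hgeo : IsKGeodetic A k) (hcard : Fintype.card V = moore 2 k + 3)
    (hA : ∀ {u v w : V}, A u w → A v w → Nout A u = Nout A v) :
    Commute (arcMatrix A) (sameOutMatrix A * sameInMatrix A) := by
  have h := walks_add_sameOut_mul_sameIn_eq_one hreg hk hgeo hcard hA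
  have hS : Commute (arcMatrix A) (∑ m ∈ Finset.range k, arcMatrix A ^ (m + 1)) :=
    Commute.sum_right _ _ _ fun m _ => Commute.self_pow _ _
  have hJ : Commute (arcMatrix A) (Matrix.of fun _ _ => 1) := by
    ext u v
    simp [Matrix.mul_apply, hreg.sum_arcMatrix_row, hreg.sum_arcMatrix_col]
  rw [← h, commute_iff_eq, mul_add, add_mul, hS.eq] at hJ
  exact add_left_cancel hJ

end

/-- For `k ≥ 3`, any diregular `(2,k,+3)`-digraph contains a pair of vertices
with exactly one common out-neighbour. -/
theorem exists_pair_unique_common_outneighbour {V : Type*} [Fintype V]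
    (A : V → V → Prop) (k : ℕ) (hk : 3 ≤ k) (hirr : Irreflexive A)
    (hreg : IsDiregular A 2) (hgeo : IsKGeodetic A k)
    (hcard : Fintype.card V = moore 2 k + 3) :
    ∃ u v : V, u ≠ v ∧ (Nout A u ∩ Nout A v).ncard = 1 := by
  classical
  by_contra hno
  push Not at hno
  have hA : ∀ {u v w : V}, A u w → A v w → Nout A u = Nout A v :=
    fun hu hv => nout_eq_of_common hreg hno hu hv
  have hcomm := (arcMatrix_commute_sameOut_mul_sameIn hreg (by omega) hgeo hcard hA).eq
  have hne : Nonempty V := Fintype.card_pos_iff.1 (by omega)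
  obtain ⟨s⟩ := hne
  obtain ⟨p, q, hpq, hs⟩ := Set.ncard_eq_two.1 (hreg s).2
  have hps : A p s := (Set.ext_iff.1 hs p).2 (by simp)
  have hqs : A q s := (Set.ext_iff.1 hs q).2 (by simp)
  obtain ⟨e, hep⟩ := hreg.nonempty_nin two_ne_zero p
  have hleft : (arcMatrix A * (sameOutMatrix A * sameInMatrix A)) e q ≠ 0 := by
    simp only [Matrix.mul_apply, ne_eq, Finset.sum_eq_zero_iff, Finset.mem_univ, mul_eq_zero,
      true_implies]
    intro h
    rcases h p with h | h
    · exact arcMatrix_ne_zero.2 hep h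
    · rcases h q with h | h
      · exact sameOutMatrix_ne_zero.2 (hA hps hqs) h
      · exact sameInMatrix_ne_zero.2 rfl h
  rw [hcomm, Matrix.mul_apply] at hleft
  obtain ⟨h, -, hh⟩ := Finset.exists_ne_zero_of_sum_ne_zero hleft
  have hhq : A h q := arcMatrix_ne_zero.1 (right_ne_zero_of_mul hh)
  have hprod := left_ne_zero_of_mul hh
  rw [Matrix.mul_apply] at hprod
  obtain ⟨g, -, hg⟩ := Finset.exists_ne_zero_of_sum_ne_zero hprod
  have hgp : A g p :=
    (Set.ext_iff.1 (sameOutMatrix_ne_zero.1 (left_ne_zero_of_mul hg)) p).1 hep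
  obtain ⟨r, hrg⟩ := hreg.nonempty_nin two_ne_zero g
  have hrh : A r h :=
    (Set.ext_iff.1 (sameInMatrix_ne_zero.1 (right_ne_zero_of_mul hg)) r).1 hrg
  have heq := hgeo r s _ _ ((((isWalkFrom_singleton s).cons hps).cons hgp).cons hrg)
    ((((isWalkFrom_singleton s).cons hqs).cons hhq).cons hrh) (by simp; omega) (by simp; omega)
  simp only [List.cons.injEq] at heq
  exact hpq heq.2.2.1
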